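/- arXiv:1611.00111 — 2 statements merged into one kernel-verified Lean document; each statement's English description precedes it below -/
import Mathlib

section
/- Let d ≥ 1 be a natural number and work in the Euclidean space ℝ^d (EuclideanSpace ℝ (Fin d)). Let f₁, f₂ be two points with c_min = dist(f₁, f₂) > 0 and let c be a real number with c > c_min. Let ξ_d denote the Lebesgue volume of the unit ball in ℝ^d. Then the Lebesgue volume of the prolate hyperspheroid X_c = { x ∈ ℝ^d : dist(x, f₁) + dist(x, f₂) ≤ c } equals c · (c² − c_min²)^{(d−1)/2} · ξ_d / 2^d. -/
open MeasureTheory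

/-- The inequality defining an ellipse by its foci, in terms of the squared distances `p ^ 2`, `q ^ 2`
to the foci: it is equivalent to the quadratic inequality as long as `|q - p| < c`. -/
lemma add_le_iff_of_abs_sub_lt {p q c : ℝ} (hp : 0 ≤ p) (hq : 0 ≤ q) (h : |q - p| < c) :
    p + q ≤ c ↔ (p ^ 2 + q ^ 2) / 2 - ((q ^ 2 - p ^ 2) / 2) ^ 2 / c ^ 2 ≤ c ^ 2 / 4 := by
  have hc : 0 < c := (abs_nonneg _).trans_lt h
  have hδ : 0 < c ^ 2 - (q - p) ^ 2 := by
    have := sq_lt_sq' (abs_lt.1 h).1 (abs_lt.1 h).2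
    linarith
  have key : (p ^ 2 + q ^ 2) / 2 - ((q ^ 2 - p ^ 2) / 2) ^ 2 / c ^ 2 - c ^ 2 / 4
      = ((p + q) ^ 2 - c ^ 2) * ((c ^ 2 - (q - p) ^ 2) / (4 * c ^ 2)) := by
    field_simp
    ring
  have hδ' : 0 < (c ^ 2 - (q - p) ^ 2) / (4 * c ^ 2) := by positivity
  rw [← sub_nonpos (b := c ^ 2 / 4), key,
    ← pow_le_pow_iff_left₀ (add_nonneg hp hq) hc.le two_ne_zero, ← sub_nonpos]
  constructor
  · exact fun h' ↦ mul_nonpos_of_nonpos_of_nonneg h' hδ'.le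
  · intro h'
    by_contra! h''
    exact absurd (mul_pos h'' hδ') h'.not_gt

/-- The coefficient `k` for which `y ↦ y + k ⟪u, y⟫ u` scales the direction of `u` by
`√(c ^ 2 - ‖u‖ ^ 2) / c`, the ratio of the minor to the major axis of the spheroid with focal
vector `u` and transverse diameter `c`. -/
noncomputable def spheroidCoeff (D c : ℝ) : ℝ := (√(c ^ 2 - D ^ 2) / c - 1) / D ^ 2

section

variable {E : Type*} [NormedAddCommGroup E] [InnerProductSpace ℝ E]

/-- The linear map carrying a centred prolate hyperspheroid with focal vector `u` and transverse
diameter `c` onto a ball whose radius is the minor semi-axis. -/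
noncomputable def spheroidMap (u : E) (c : ℝ) : E →ₗ[ℝ] E :=
  LinearMap.transvection (innerₛₗ ℝ u) (spheroidCoeff ‖u‖ c • u)

lemma spheroidMap_apply (u : E) (c : ℝ) (y : E) :
    spheroidMap u c y = y + (inner ℝ u y * spheroidCoeff ‖u‖ c) • u := by
  simp [spheroidMap, LinearMap.transvection.apply, smul_smul]

lemma one_add_spheroidCoeff_mul {D : ℝ} (hD : D ≠ 0) (c : ℝ) :
    1 + spheroidCoeff D c * D ^ 2 = √(c ^ 2 - D ^ 2) / c := by
  rw [spheroidCoeff]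
  field_simp
  ring

lemma det_spheroidMap [FiniteDimensional ℝ E] {u : E} (hu : u ≠ 0) (c : ℝ) :
    LinearMap.det (spheroidMap u c) = √(c ^ 2 - ‖u‖ ^ 2) / c := by
  rw [spheroidMap, LinearMap.transvection.det, ← one_add_spheroidCoeff_mul (norm_ne_zero_iff.2 hu)]
  simp

lemma norm_sq_spheroidMap {u : E} (hu : u ≠ 0) {c : ℝ} (hc : ‖u‖ < c) (y : E) :
    ‖spheroidMap u c y‖ ^ 2 = ‖y‖ ^ 2 - inner ℝ u y ^ 2 / c ^ 2 := by
  have hD : 0 < ‖u‖ := norm_pos_iff.2 hu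
  have hc0 : 0 < c := hD.trans hc
  have hk := one_add_spheroidCoeff_mul hD.ne' c
  have hs : √(c ^ 2 - ‖u‖ ^ 2) ^ 2 = c ^ 2 - ‖u‖ ^ 2 := Real.sq_sqrt (by nlinarith)
  set k := spheroidCoeff ‖u‖ c with hkdef
  have hk2 : (1 + k * ‖u‖ ^ 2) ^ 2 = (c ^ 2 - ‖u‖ ^ 2) / c ^ 2 := by rw [hk, div_pow, hs]
  have hcoeff : 2 * k + k ^ 2 * ‖u‖ ^ 2 = -1 / c ^ 2 := by
    field_simp at hk2 ⊢
    have : ‖u‖ ^ 2 * ((2 * k + k ^ 2 * ‖u‖ ^ 2) * c ^ 2) = ‖u‖ ^ 2 * (-1) := by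
      linear_combination hk2
    have := mul_left_cancel₀ (by positivity) this
    linear_combination this
  rw [spheroidMap_apply, norm_add_sq_real, norm_smul, inner_smul_right, mul_pow, Real.norm_eq_abs,
    sq_abs, real_inner_comm u y, ← hkdef]
  linear_combination inner ℝ u y ^ 2 * hcoeff

lemma dist_add_dist_le_iff {f₁ f₂ : E} (hf : f₁ ≠ f₂) {c : ℝ} (hc : dist f₁ f₂ < c) (x : E) :
    dist x f₁ + dist x f₂ ≤ c ↔
      ‖spheroidMap (f₁ - f₂) c (x - midpoint ℝ f₁ f₂)‖ ≤ √(c ^ 2 - dist f₁ f₂ ^ 2) / 2 := by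
  have hc' : 0 < c := dist_nonneg.trans_lt hc
  have hle : 0 ≤ c ^ 2 - dist f₁ f₂ ^ 2 := by nlinarith [dist_nonneg (x := f₁) (y := f₂)]
  have habs : |dist x f₂ - dist x f₁| < c := by
    refine lt_of_le_of_lt ?_ hc
    rw [dist_comm x f₁, dist_comm x f₂, dist_comm f₁ f₂]
    exact abs_dist_sub_le f₂ f₁ x
  rw [add_le_iff_of_abs_sub_lt dist_nonneg dist_nonneg habs,
    ← pow_le_pow_iff_left₀ (norm_nonneg _) (by positivity) two_ne_zero, div_pow (√_), Real.sq_sqrt hle,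
    norm_sq_spheroidMap (sub_ne_zero.2 hf) (by rwa [← dist_eq_norm])]
  set y := x - midpoint ℝ f₁ f₂ with hy
  have h1 : x - f₁ = y - (2⁻¹ : ℝ) • (f₁ - f₂) := by
    rw [hy, midpoint_eq_smul_add, invOf_eq_inv]; module
  have h2 : x - f₂ = y + (2⁻¹ : ℝ) • (f₁ - f₂) := by
    rw [hy, midpoint_eq_smul_add, invOf_eq_inv]; module
  rw [dist_eq_norm, dist_eq_norm, dist_eq_norm, h1, h2, norm_sub_sq_real, norm_add_sq_real,
    norm_smul, inner_smul_right, real_inner_comm _ y, mul_pow, Real.norm_eq_abs, sq_abs]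
  constructor <;> intro h <;> ring_nf at h ⊢ <;> linarith

end

/-- Volume of the prolate hyperspheroid (informed subset) with foci `f₁, f₂`,
focal distance `c_min = dist f₁ f₂ > 0` and transverse diameter `c > c_min`:
`vol {x | dist x f₁ + dist x f₂ ≤ c} = c (c² − c_min²)^{(d−1)/2} ξ_d / 2^d`,
where `ξ_d` is the volume of the unit ball in `ℝ^d`. -/
theorem stmt_3 (d : ℕ) (hd : 1 ≤ d) (f₁ f₂ : EuclideanSpace ℝ (Fin d))
    (hpos : 0 < dist f₁ f₂) (c : ℝ) (hc : dist f₁ f₂ < c) :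
    volume {x : EuclideanSpace ℝ (Fin d) | dist x f₁ + dist x f₂ ≤ c}
      = ENNReal.ofReal
          (c * (c ^ 2 - dist f₁ f₂ ^ 2) ^ (((d : ℝ) - 1) / 2)
            * (volume (Metric.ball (0 : EuclideanSpace ℝ (Fin d)) 1)).toReal
            / 2 ^ d) := by
  have hf : f₁ ≠ f₂ := dist_pos.1 hpos
  have hc0 : 0 < c := hpos.trans hc
  have hgap : 0 < c ^ 2 - dist f₁ f₂ ^ 2 := by nlinarith
  have hr : 0 < √(c ^ 2 - dist f₁ f₂ ^ 2) := Real.sqrt_pos.2 hgap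
  have hdet : LinearMap.det (spheroidMap (f₁ - f₂) c) = √(c ^ 2 - dist f₁ f₂ ^ 2) / c := by
    rw [det_spheroidMap (sub_ne_zero.2 hf), dist_eq_norm]
  have hset : {x : EuclideanSpace ℝ (Fin d) | dist x f₁ + dist x f₂ ≤ c} =
      (fun x ↦ x + -midpoint ℝ f₁ f₂) ⁻¹' (spheroidMap (f₁ - f₂) c ⁻¹'
        Metric.closedBall 0 (√(c ^ 2 - dist f₁ f₂ ^ 2) / 2)) := by
    ext x
    simp only [Set.mem_ofPred_eq, Set.mem_preimage, mem_closedBall_zero_iff, ← sub_eq_add_neg]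
    exact dist_add_dist_le_iff hf hc x
  have hpow : (c ^ 2 - dist f₁ f₂ ^ 2) ^ (((d : ℝ) - 1) / 2)
      = √(c ^ 2 - dist f₁ f₂ ^ 2) ^ (d - 1) := by
    rw [Real.sqrt_eq_rpow, ← Real.rpow_mul_natCast hgap.le, Nat.cast_sub hd]
    congr 1
    push_cast
    ring
  rw [hset, measure_preimage_add_right,
    Measure.addHaar_preimage_linearMap _ (by rw [hdet]; positivity), hdet, Measure.addHaar_closedBall _ _ (by positivity), finrank_euclideanSpace_fin, hpow,
    ← ENNReal.ofReal_toReal (measure_ball_lt_top (μ := volume)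
      (x := (0 : EuclideanSpace ℝ (Fin d))) (r := 1)).ne,
    ← ENNReal.ofReal_mul (by positivity), ← ENNReal.ofReal_mul (by positivity),
    ENNReal.toReal_ofReal ENNReal.toReal_nonneg, abs_of_nonneg (by positivity)]
  congr 1
  obtain ⟨n, rfl⟩ := Nat.exists_eq_add_of_le' hd
  rw [Nat.add_sub_cancel, div_pow, pow_succ (√_)]
  field_simp
end

section
/- Let d ≥ 1 and n ≥ 1 be natural numbers and let c > 0 be a real number. For each natural number i set r_i = c · n^{-1/d} · 2^{i/d}, and let ν : ℕ → ℝ satisfy 0 ≤ ν i for all i, ν 0 ≤ n, and ν i ≤ 2^{-(i−1)(d−1)/(2d)} · n for all i ≥ 1. Then ∑_{i=0}^{⌊log₂ n⌋} (ν i)² · (r_i)^d ≤ (2 · c^d / (2^{1/d} − 1)) · n^{1 + 1/d}. -/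
/-- The `d`-th power of the radius `c n^{-1/d} 2^{i/d}`. -/
lemma radius_rpow {d n c : ℝ} (hd : d ≠ 0) (hn : 0 < n) (hc : 0 ≤ c) (i : ℕ) :
    (c * n ^ (-(1 : ℝ) / d) * (2 : ℝ) ^ ((i : ℝ) / d)) ^ d = c ^ d * n⁻¹ * 2 ^ i := by
  rw [Real.mul_rpow (by positivity) (by positivity), Real.mul_rpow hc (by positivity),
    ← Real.rpow_mul hn.le, ← Real.rpow_mul zero_le_two, div_mul_cancel₀ _ hd,
    div_mul_cancel₀ _ hd, Real.rpow_neg_one, Real.rpow_natCast]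

/-- The squared decay of the vertex bound against the doubling of `r ^ d` leaves growth
of ratio `2^{1/d}`. -/
lemma sq_two_rpow_mul_two_pow {d : ℝ} (hd : d ≠ 0) (i : ℕ) :
    ((2 : ℝ) ^ (-(i : ℝ) * (d - 1) / (2 * d))) ^ 2 * 2 ^ (i + 1)
      = 2 * ((2 : ℝ) ^ ((1 : ℝ) / d)) ^ i := by
  rw [← Real.rpow_natCast, ← Real.rpow_mul zero_le_two, ← Real.rpow_natCast 2 (i + 1),
    ← Real.rpow_add zero_lt_two, ← Real.rpow_natCast _ i, ← Real.rpow_mul zero_le_two]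
  have h (x : ℝ) : 2 * (2 : ℝ) ^ x = 2 ^ (1 + x) := by
    rw [Real.rpow_add zero_lt_two, Real.rpow_one]
  rw [h]
  congr 1
  push_cast
  field_simp
  ring

/-- A sum with `f 0 ≤ A` and increments at most `2 A q ^ i` is at most `2 A q ^ m / (q - 1)`. -/
lemma sum_range_succ_le_of_geometric {f : ℕ → ℝ} {A q : ℝ} (hA : 0 ≤ A) (hq : 1 < q)
    (hq3 : q ≤ 3) (h0 : f 0 ≤ A) (hf : ∀ i, f (i + 1) ≤ 2 * A * q ^ i) (m : ℕ) :
    ∑ i ∈ Finset.range (m + 1), f i ≤ 2 * A * q ^ m / (q - 1) := by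
  have hq' : 0 < q - 1 := sub_pos.2 hq
  induction m with
  | zero =>
    rw [Finset.sum_range_one, le_div_iff₀ hq']
    nlinarith
  | succ k ih =>
    rw [Finset.sum_range_succ]
    refine (add_le_add ih (hf k)).trans_eq ?_
    field_simp
    ring

/-- For a floor logarithm in base two, `(2^{1/d})^{⌊log₂ n⌋} ≤ n^{1/d}`. -/
lemma two_rpow_pow_log_le {n : ℕ} (hn : n ≠ 0) {a : ℝ} (ha : 0 ≤ a) :
    ((2 : ℝ) ^ a) ^ Nat.log 2 n ≤ (n : ℝ) ^ a := by
  rw [Real.rpow_pow_comm zero_le_two]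
  have h : (2 : ℝ) ^ Nat.log 2 n ≤ n := by exact_mod_cast Nat.pow_log_le_self 2 hn
  exact Real.rpow_le_rpow (by positivity) h ha


/-- Worst-case total edge-evaluation bound for edge batching with pruning:
with `r_i = c n^{-1/d} 2^{i/d}`, `ν 0 ≤ n` and `ν i ≤ 2^{-(i−1)(d−1)/(2d)} n`
for `i ≥ 1`, the total work `∑_{i=0}^{⌊log₂ n⌋} (ν i)² r_i^d` is at most
`(2 c^d / (2^{1/d} − 1)) n^{1+1/d}`. -/
theorem stmt_8 (d n : ℕ) (hd : 1 ≤ d) (hn : 1 ≤ n) (c : ℝ) (hc : 0 < c)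
    (ν : ℕ → ℝ) (hν0 : ∀ i, 0 ≤ ν i) (hν00 : ν 0 ≤ n)
    (hνi : ∀ i : ℕ, 1 ≤ i →
      ν i ≤ (2 : ℝ) ^ (-((i : ℝ) - 1) * ((d : ℝ) - 1) / (2 * d)) * n) :
    ∑ i ∈ Finset.range (Nat.log 2 n + 1),
        (ν i) ^ 2 * (c * (n : ℝ) ^ (-(1 : ℝ) / d) * (2 : ℝ) ^ ((i : ℝ) / d)) ^ (d : ℝ)
      ≤ (2 * c ^ (d : ℝ) / ((2 : ℝ) ^ ((1 : ℝ) / d) - 1))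
          * (n : ℝ) ^ (1 + (1 : ℝ) / d) := by
  have hd0 : (0 : ℝ) < d := by exact_mod_cast hd
  have hn0 : (0 : ℝ) < n := by exact_mod_cast hn
  have hcd : 0 < c ^ (d : ℝ) := Real.rpow_pos_of_pos hc _
  have hq : 1 < (2 : ℝ) ^ ((1 : ℝ) / d) := Real.one_lt_rpow one_lt_two (by positivity)
  have hq2 : (2 : ℝ) ^ ((1 : ℝ) / d) ≤ 2 :=
    Real.rpow_le_self_of_one_le one_le_two
      ((div_le_one hd0).2 (by exact_mod_cast hd))
  have hq' : 0 < (2 : ℝ) ^ ((1 : ℝ) / d) - 1 := sub_pos.2 hq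
  simp only [radius_rpow hd0.ne' hn0 hc.le]
  refine (sum_range_succ_le_of_geometric (A := c ^ (d : ℝ) * n) (by positivity) hq
    (by linarith) ?_ (fun i => ?_) _).trans ?_
  · calc ν 0 ^ 2 * (c ^ (d : ℝ) * (n : ℝ)⁻¹ * 2 ^ 0)
        ≤ (n : ℝ) ^ 2 * (c ^ (d : ℝ) * (n : ℝ)⁻¹ * 2 ^ 0) := by
          gcongr
          exact hν0 0
      _ = c ^ (d : ℝ) * n := by field_simp
  · have h := hνi (i + 1) (Nat.le_add_left 1 i)
    rw [Nat.cast_add_one, add_sub_cancel_right] at h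
    calc ν (i + 1) ^ 2 * (c ^ (d : ℝ) * (n : ℝ)⁻¹ * 2 ^ (i + 1))
        ≤ ((2 : ℝ) ^ (-(i : ℝ) * ((d : ℝ) - 1) / (2 * d)) * n) ^ 2
            * (c ^ (d : ℝ) * (n : ℝ)⁻¹ * 2 ^ (i + 1)) := by
          gcongr
          exact hν0 (i + 1)
      _ = (((2 : ℝ) ^ (-(i : ℝ) * ((d : ℝ) - 1) / (2 * d))) ^ 2 * 2 ^ (i + 1))
            * (c ^ (d : ℝ) * n) := by field_simp
      _ = 2 * (c ^ (d : ℝ) * n) * ((2 : ℝ) ^ ((1 : ℝ) / d)) ^ i := by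
          rw [sq_two_rpow_mul_two_pow hd0.ne']
          ring
  · have hlog := two_rpow_pow_log_le (Nat.one_le_iff_ne_zero.1 hn)
      (one_div_nonneg.2 hd0.le)
    rw [Real.rpow_add hn0, Real.rpow_one, div_mul_eq_mul_div, ← mul_assoc, ← mul_assoc]
    gcongr
end
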